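/- Let d ≥ 2 and ξ ≥ 1 be integers and let P_ξ^* be the set of integers of the form ∏_{j=1}^ξ p_j^{a_j} with each a_j ∈ {0, 1, …, d−1}, excluding 1, where p_j is the j-th prime. There exists a constant C > 0 (depending only on d and ξ) such that for every α ∈ [0, 1) and every positive integer n there exists a function c : P_ξ^* → ℤ with max_{f ∈ P_ξ^*} |c_f| ≤ n satisfying 0 ≤ α − { Σ_{f ∈ P_ξ^*} c_f · f^{1/d} } ≤ C · n^{−d^ξ + 1}, where {·} denotes the fractional part. -/

import Mathlib

/-- `PstarSet d ξ` : the set of integers ∏_{j=1}^ξ p_j^{a_j} with a_j ∈ {0,…,d−1},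
excluding 1, where p_j is the j-th prime. -/
noncomputable def PstarSet (d ξ : ℕ) : Finset ℕ :=
  (Finset.image
    (fun a : Fin ξ → Fin d => ∏ j : Fin ξ, (Nat.nth Nat.Prime (j : ℕ)) ^ ((a j : ℕ)))
    Finset.univ).erase 1

open Polynomial in
/-- A positive real root of `X ^ k - a` none of whose smaller powers is rational has minimal
polynomial `X ^ k - a`, since all complex conjugates have the same absolute value. -/
theorem minpoly_eq_X_pow_sub_C_of_pow_eq {x : ℝ} (hx : 0 < x) {k : ℕ} (hk : 0 < k) {a : ℚ}
    (hxk : x ^ k = a) (hmin : ∀ r : ℕ, 0 < r → r < k → ∀ b : ℚ, x ^ r ≠ b) :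
    minpoly ℚ x = X ^ k - C a := by
  have hmonic : (X ^ k - C a : ℚ[X]).Monic := monic_X_pow_sub_C a hk.ne'
  have hroot : aeval x (X ^ k - C a : ℚ[X]) = 0 := by simp [hxk]
  have hint : IsIntegral ℚ x := ⟨_, hmonic, hroot⟩
  have hdvd : minpoly ℚ x ∣ X ^ k - C a := minpoly.dvd ℚ x hroot
  set P := minpoly ℚ x with hP
  have hPm : P.Monic := minpoly.monic hint
  have hsplit : (P.map (algebraMap ℚ ℂ)).Splits := IsAlgClosed.splits _
  have hnorm : ∀ z ∈ (P.map (algebraMap ℚ ℂ)).roots, ‖z‖ = x := by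
    intro z hz
    have hz0 : aeval z P = 0 := by
      have := (mem_roots'.mp hz).2
      rwa [IsRoot, eval_map_algebraMap] at this
    have hzk : z ^ k = (a : ℂ) := by
      have := aeval_eq_zero_of_dvd_aeval_eq_zero hdvd hz0
      simpa [sub_eq_zero] using this
    have hxk' : ‖z‖ ^ k = x ^ k := by
      rw [← norm_pow, hzk, ← Complex.ofReal_ratCast, ← hxk, Complex.norm_real, Real.norm_eq_abs,
        abs_of_pos (pow_pos hx k)]
    exact (pow_left_inj₀ (norm_nonneg z) hx.le hk.ne').mp hxk'
  have hcoeff : ((|P.coeff 0| : ℚ) : ℝ) = x ^ P.natDegree := by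
    have h := hsplit.coeff_zero_eq_prod_roots_of_monic (hPm.map _)
    have h' := congrArg norm h
    rw [coeff_map, norm_mul, norm_pow, norm_neg, norm_one, one_pow, one_mul,
      show ‖(P.map (algebraMap ℚ ℂ)).roots.prod‖ = ((P.map (algebraMap ℚ ℂ)).roots.map norm).prod
        from map_multiset_prod (normHom : ℂ →*₀ ℝ) _] at h'
    rw [Multiset.map_congr rfl (g := fun _ => x) (fun z hz => hnorm z hz), Multiset.map_const',
      Multiset.prod_replicate, ← hsplit.natDegree_eq_card_roots, natDegree_map] at h'
    rw [← h', eq_ratCast, Complex.norm_ratCast, Rat.cast_abs]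
  have hkr : k ≤ P.natDegree := by
    by_contra! hlt
    exact hmin _ (minpoly.natDegree_pos hint) hlt _ hcoeff.symm
  refine (eq_of_monic_of_dvd_of_natDegree_le hPm hmonic hdvd ?_).symm
  rwa [natDegree_X_pow_sub_C]

theorem nextCoeff_minpoly_eq_zero_of_pow_eq {x : ℝ} (hx : 0 < x) {d : ℕ} (hd : 0 < d)
    {a : ℚ} (hxd : x ^ d = a) (hirr : Irrational x) : (minpoly ℚ x).nextCoeff = 0 := by
  classical
  have hex : ∃ k : ℕ, 0 < k ∧ ∃ b : ℚ, x ^ k = b := ⟨d, hd, a, hxd⟩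
  obtain ⟨hk, b, hb⟩ := Nat.find_spec hex
  set k := Nat.find hex
  have hk1 : k ≠ 1 := fun h => hirr ⟨b, by rw [← hb, h, pow_one]⟩
  rw [minpoly_eq_X_pow_sub_C_of_pow_eq hx hk hb fun r hr hrk c hc =>
    Nat.find_min hex hrk ⟨hr, c, hc⟩]
  rw [Polynomial.nextCoeff_of_natDegree_pos (by rwa [Polynomial.natDegree_X_pow_sub_C]),
    Polynomial.natDegree_X_pow_sub_C, Polynomial.coeff_sub, Polynomial.coeff_X_pow,
    Polynomial.coeff_C, if_neg (by omega), if_neg (by omega), sub_zero]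

/-- Positive real radicals with pairwise irrational ratios are linearly independent over `ℚ`. -/
theorem linearIndependent_of_pow_eq_of_irrational_div {ι : Type*} [Finite ι] {θ : ι → ℝ}
    (hθ : ∀ i, 0 < θ i) {d : ℕ} (hd : 0 < d) (hpow : ∀ i, ∃ a : ℚ, θ i ^ d = a)
    (hirr : ∀ i j, i ≠ j → Irrational (θ i / θ j)) : LinearIndependent ℚ θ := by
  have := Fintype.ofFinite ι
  have hint : ∀ x ∈ Set.range θ, IsIntegral ℚ x := by
    rintro _ ⟨i, rfl⟩
    obtain ⟨a, ha⟩ := hpow i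
    refine IsIntegral.of_pow hd ?_
    rw [ha]
    exact isIntegral_algebraMap (x := a)
  let K := IntermediateField.adjoin ℚ (Set.range θ)
  have hfin : FiniteDimensional ℚ K :=
    IntermediateField.finiteDimensional_adjoin hint
  let η : ι → K := fun i => ⟨θ i, IntermediateField.subset_adjoin ℚ _ ⟨i, rfl⟩⟩
  have hη : ∀ i, ((η i : K) : ℝ) = θ i := fun i => rfl
  have hη0 : ∀ i, η i ≠ 0 := fun i h => (hθ i).ne' (by rw [← hη, h]; rfl)
  have htrace : ∀ i j, i ≠ j → Algebra.trace ℚ K (η i / η j) = 0 := by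
    intro i j hij
    obtain ⟨a, ha⟩ := hpow i
    obtain ⟨b, hb⟩ := hpow j
    have hmin : minpoly ℚ (η i / η j) = minpoly ℚ (θ i / θ j) :=
      (minpoly.algebraMap_eq (algebraMap K ℝ).injective (η i / η j)).symm
    rw [trace_eq_finrank_mul_minpoly_nextCoeff, hmin,
      nextCoeff_minpoly_eq_zero_of_pow_eq (div_pos (hθ i) (hθ j)) hd (a := a / b)
        (by rw [div_pow, ha, hb]; push_cast; rfl) (hirr i j hij), neg_zero, mul_zero]
  rw [Fintype.linearIndependent_iff]
  intro g hg j
  have hg' : ∑ i, g i • η i = 0 := by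
    apply (algebraMap K ℝ).injective
    rw [map_sum, map_zero, ← hg]
    rfl
  have h1 : ∑ i, g i • (η i / η j) = 0 := by
    rw [← zero_div (η j), ← hg', Finset.sum_div]
    simp only [smul_div_assoc]
  have h2 := congrArg (Algebra.trace ℚ K) h1
  rw [map_sum, map_zero, Finset.sum_eq_single j
    (fun i _ hij => by rw [map_smul, htrace i j hij, smul_zero]) (by simp), map_smul,
    div_self (hη0 j), ← map_one (algebraMap ℚ K), Algebra.trace_algebraMap] at h2
  have h3 : (Module.finrank ℚ K : ℚ) ≠ 0 := by exact_mod_cast Module.finrank_pos.ne'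
  simpa [h3] using h2

/-- Dirichlet's theorem for a linear form without nontrivial integer zeros, with a positive value. -/
theorem exists_pos_linear_form_lt {ι : Type*} [Fintype ι] [DecidableEq ι] {θ : ι → ℝ}
    (hθ : ∀ i, 0 < θ i) (hlin : ∀ v : ι → ℤ, ∑ i, (v i : ℝ) * θ i = 0 → v = 0)
    {i₀ : ι} (h₀ : θ i₀ = 1) {m : ℕ} (hm : m ≠ 0) (hcard : Fintype.card ι = m + 1)
    {N : ℕ} (hN : 0 < N) :
    ∃ q : ι → ℤ, (∀ i, |(q i : ℝ)| ≤ (1 + ∑ i, θ i) * N) ∧ 0 < ∑ i, (q i : ℝ) * θ i ∧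
      ∑ i, (q i : ℝ) * θ i < 1 / (N : ℝ) ^ m := by
  let L : (ι → ℤ) → ℝ := fun v => ∑ i, (v i : ℝ) * θ i
  have hNm : (0 : ℝ) < (N : ℝ) ^ m := by positivity
  let s : Finset (ι → ℤ) := Fintype.piFinset fun i => if i = i₀ then {0} else Finset.Icc 0 (N : ℤ)
  have hs : s.card = (N + 1) ^ m := by
    simp only [s, Fintype.card_piFinset]
    rw [← Finset.mul_prod_erase _ _ (Finset.mem_univ i₀),
      Finset.prod_congr rfl (g := fun _ => N + 1)]
    · simp [hcard]
    · intro i hi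
      rw [if_neg (Finset.ne_of_mem_erase hi)]
      simp
  have hmem : ∀ v ∈ s, v i₀ = 0 ∧ ∀ i, 0 ≤ v i ∧ v i ≤ N := by
    intro v hv
    have hv' := fun i => Fintype.mem_piFinset.mp hv i
    have h0 : v i₀ = 0 := by simpa using hv' i₀
    refine ⟨h0, fun i => ?_⟩
    by_cases hi : i = i₀
    · subst hi; simp [h0]
    · simpa [hi] using hv' i
  have hmaps : Set.MapsTo (fun v : ι → ℤ => ⌊Int.fract (L v) * (N : ℝ) ^ m⌋₊)
      (s : Set (ι → ℤ)) (Finset.range (N ^ m) : Set ℕ) := by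
    intro v _
    rw [Finset.mem_coe, Finset.mem_range, Nat.floor_lt (by positivity)]
    push_cast
    exact mul_lt_of_lt_one_left hNm (Int.fract_lt_one _)
  have hlt : (Finset.range (N ^ m)).card < s.card := by
    rw [Finset.card_range, hs]
    exact Nat.pow_lt_pow_left (Nat.lt_succ_self N) hm
  obtain ⟨v, hv, w, hw, hvw, heq⟩ := Finset.exists_ne_map_eq_of_card_lt_of_maps_to hlt hmaps
  have key : ∀ v ∈ s, ∀ w ∈ s, v ≠ w → Int.fract (L w) ≤ Int.fract (L v) →
      ⌊Int.fract (L v) * (N : ℝ) ^ m⌋₊ = ⌊Int.fract (L w) * (N : ℝ) ^ m⌋₊ →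
      ∃ q : ι → ℤ, (∀ i, |(q i : ℝ)| ≤ (1 + ∑ i, θ i) * N) ∧ 0 < ∑ i, (q i : ℝ) * θ i ∧
        ∑ i, (q i : ℝ) * θ i < 1 / (N : ℝ) ^ m := by
    intro v hv w hw hvw hle heq
    let q : ι → ℤ := fun i => v i - w i - if i = i₀ then ⌊L v⌋ - ⌊L w⌋ else 0
    have hLq : ∑ i, (q i : ℝ) * θ i = Int.fract (L v) - Int.fract (L w) := by
      have : ∀ i, (q i : ℝ) * θ i = (v i : ℝ) * θ i - (w i : ℝ) * θ i -
          if i = i₀ then ((⌊L v⌋ : ℝ) - ⌊L w⌋) else 0 := by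
        intro i
        by_cases hi : i = i₀
        · subst hi; simp [q, h₀]
        · simp [q, hi, sub_mul]
      simp only [this, Finset.sum_sub_distrib, Finset.sum_ite_eq', Finset.mem_univ, if_true]
      simp only [Int.fract, L]
      ring
    have hqi : ∀ i, i ≠ i₀ → q i = v i - w i := fun i hi => by simp [q, hi]
    have hq0 : q ≠ 0 := by
      intro h
      apply hvw
      ext i
      by_cases hi : i = i₀
      · rw [hi, (hmem v hv).1, (hmem w hw).1]
      · have := congrFun h i
        rw [hqi i hi] at this
        simpa [sub_eq_zero] using this
    have hpos : 0 < ∑ i, (q i : ℝ) * θ i :=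
      lt_of_le_of_ne (by rw [hLq]; linarith) fun h => hq0 (hlin q h.symm)
    have hup : ∑ i, (q i : ℝ) * θ i < 1 / (N : ℝ) ^ m := by
      rw [hLq, lt_div_iff₀ hNm]
      have h1 := Nat.lt_floor_add_one (Int.fract (L v) * (N : ℝ) ^ m)
      have h2 := Nat.floor_le (a := Int.fract (L w) * (N : ℝ) ^ m) (by positivity)
      rw [heq] at h1
      linarith
    have hle1 : 1 / (N : ℝ) ^ m ≤ 1 := by
      rw [div_le_one hNm]
      exact one_le_pow₀ (by exact_mod_cast hN)
    have hN1 : (1 : ℝ) ≤ N := by exact_mod_cast hN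
    have hsum : 0 ≤ ∑ i, θ i := Finset.sum_nonneg fun i _ => (hθ i).le
    have hbd : ∀ i, i ≠ i₀ → |(q i : ℝ)| ≤ N := by
      intro i hi
      rw [hqi i hi, ← Int.cast_abs]
      have h1 := (hmem v hv).2 i
      have h2 := (hmem w hw).2 i
      have : |v i - w i| ≤ N := abs_le.mpr ⟨by omega, by omega⟩
      exact_mod_cast this
    refine ⟨q, fun i => ?_, hpos, hup⟩
    by_cases hi : i = i₀
    · subst hi
      have hsplit := Finset.add_sum_erase Finset.univ (fun j => (q j : ℝ) * θ j)
        (Finset.mem_univ i)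
      have hrest : |∑ j ∈ Finset.univ.erase i, (q j : ℝ) * θ j| ≤ (∑ j, θ j) * N := by
        refine (Finset.abs_sum_le_sum_abs _ _).trans ?_
        rw [Finset.sum_mul]
        refine (Finset.sum_le_sum fun j hj => ?_).trans
          (Finset.sum_le_sum_of_subset_of_nonneg (Finset.erase_subset i _)
            fun j _ _ => mul_nonneg (hθ j).le (Nat.cast_nonneg N))
        rw [abs_mul, abs_of_pos (hθ j), mul_comm]
        exact mul_le_mul_of_nonneg_left (hbd j (Finset.ne_of_mem_erase hj)) (hθ j).le
      rw [h₀, mul_one] at hsplit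
      rw [abs_le] at hrest ⊢
      constructor <;> nlinarith [hrest.1, hrest.2]
    · nlinarith [hbd i hi]
  rcases le_total (Int.fract (L w)) (Int.fract (L v)) with h | h
  · exact key v hv w hw hvw h heq
  · exact key w hw v hv hvw.symm h heq.symm

/-- One-sided inhomogeneous approximation by an integral basis of a ring, with the
optimal exponent: the translates of one small element by the basis span a full-rank sublattice. -/
theorem exists_sub_linear_form_mem_Icc {ι : Type*} [Fintype ι] [DecidableEq ι] {θ : ι → ℝ}
    (hθ : ∀ i, 0 < θ i) (hlin : ∀ v : ι → ℤ, ∑ i, (v i : ℝ) * θ i = 0 → v = 0)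
    {i₀ : ι} (h₀ : θ i₀ = 1) {m : ℕ} (hm : m ≠ 0) (hcard : Fintype.card ι = m + 1)
    (hmul : ∀ i j, ∃ k : ι → ℤ, θ i * θ j = ∑ h, (k h : ℝ) * θ h) :
    ∃ D : ℕ, 0 < D ∧ ∀ α : ℝ, ∀ N : ℕ, 0 < N → ∃ w : ι → ℤ,
      (∀ i, i ≠ i₀ → |(w i : ℝ)| ≤ D * N) ∧ 0 ≤ α - ∑ i, (w i : ℝ) * θ i ∧
      α - ∑ i, (w i : ℝ) * θ i ≤ (∑ i, θ i) / (N : ℝ) ^ m := by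
  choose k hk using hmul
  let B : ℝ := 1 + ∑ i, θ i
  have hB : 0 ≤ B := add_nonneg zero_le_one (Finset.sum_nonneg fun i _ => (hθ i).le)
  let A : ℝ := ∑ g, ∑ h, ∑ f, |(k f g h : ℝ)|
  obtain ⟨D, hD⟩ := exists_nat_ge (A * B)
  refine ⟨D + 1, D.succ_pos, fun α N hN => ?_⟩
  obtain ⟨q, hqB, hX, hXN⟩ := exists_pos_linear_form_lt hθ hlin h₀ hm hcard hN
  set X : ℝ := ∑ i, (q i : ℝ) * θ i with hXdef
  let M : Matrix ι ι ℤ := Matrix.of fun g h => ∑ f, q f * k f g h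
  have hM : ∀ g, X * θ g = ∑ h, (M g h : ℝ) * θ h := by
    intro g
    simp only [M, Matrix.of_apply, Int.cast_sum, Int.cast_mul, Finset.sum_mul, hXdef]
    rw [Finset.sum_comm]
    refine Finset.sum_congr rfl fun f _ => ?_
    rw [mul_assoc, hk, Finset.mul_sum]
    exact Finset.sum_congr rfl fun h _ => by ring
  have hcomb : ∀ s : ι → ℝ, ∑ h, (∑ g, s g * (M g h : ℝ)) * θ h = X * ∑ g, s g * θ g := by
    intro s
    simp only [Finset.sum_mul, Finset.mul_sum]
    rw [Finset.sum_comm]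
    refine Finset.sum_congr rfl fun g _ => ?_
    rw [mul_left_comm, hM, Finset.mul_sum]
    exact Finset.sum_congr rfl fun h _ => by ring
  have hdet : M.det ≠ 0 := by
    intro hdet
    obtain ⟨v, hv, hvM⟩ := Matrix.exists_vecMul_eq_zero_iff.mpr hdet
    refine hv (hlin v ?_)
    have h1 := hcomb fun g => (v g : ℝ)
    have h2 : ∀ h, ∑ g, (v g : ℝ) * (M g h : ℝ) = 0 := by
      intro h
      have := congrFun hvM h
      simp only [Matrix.vecMul, dotProduct, Pi.zero_apply] at this
      exact_mod_cast this
    simp only [h2, zero_mul, Finset.sum_const_zero] at h1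
    exact (mul_eq_zero.mp h1.symm).resolve_left hX.ne'
  let MR : Matrix ι ι ℝ := M.map (Int.castRingHom ℝ)
  have hunit : IsUnit MR.det := by
    rw [isUnit_iff_ne_zero]
    have : MR.det = ((M.det : ℤ) : ℝ) := ((Int.castRingHom ℝ).map_det M).symm
    rw [this]
    exact_mod_cast hdet
  let s : ι → ℝ := Matrix.vecMul (Pi.single i₀ α) MR⁻¹
  have hs : ∀ h, ∑ g, s g * (M g h : ℝ) = (Pi.single i₀ α : ι → ℝ) h := by
    intro h
    have : Matrix.vecMul s MR = Pi.single i₀ α := by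
      rw [Matrix.vecMul_vecMul, Matrix.nonsing_inv_mul _ hunit, Matrix.vecMul_one]
    rw [← this]
    rfl
  let w : ι → ℤ := fun h => ∑ g, ⌊s g⌋ * M g h
  have hw : ∀ h, (w h : ℝ) =
      (Pi.single i₀ α : ι → ℝ) h - ∑ g, Int.fract (s g) * (M g h : ℝ) := by
    intro h
    rw [← hs, ← Finset.sum_sub_distrib]
    simp only [w, Int.cast_sum, Int.cast_mul]
    exact Finset.sum_congr rfl fun g _ => by rw [Int.fract]; ring
  have hval : α - ∑ h, (w h : ℝ) * θ h = X * ∑ g, Int.fract (s g) * θ g := by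
    simp only [hw, sub_mul, Finset.sum_sub_distrib]
    rw [hcomb, Finset.sum_eq_single i₀ (fun i _ hi => by simp [hi]) (by simp)]
    simp [h₀]
  have hfr : ∑ g, Int.fract (s g) * θ g ≤ ∑ g, θ g := Finset.sum_le_sum fun g _ =>
    mul_le_of_le_one_left (hθ g).le (Int.fract_lt_one _).le
  have hfr0 : 0 ≤ ∑ g, Int.fract (s g) * θ g := Finset.sum_nonneg fun g _ =>
    mul_nonneg (Int.fract_nonneg _) (hθ g).le
  refine ⟨w, fun h hh => ?_, ?_, ?_⟩
  · have hN0 : (0 : ℝ) ≤ N := N.cast_nonneg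
    rw [hw, Pi.single_eq_of_ne hh, zero_sub, abs_neg]
    calc |∑ g, Int.fract (s g) * (M g h : ℝ)|
        ≤ ∑ g, ∑ f, |(k f g h : ℝ)| * (B * N) := by
          refine (Finset.abs_sum_le_sum_abs _ _).trans (Finset.sum_le_sum fun g _ => ?_)
          rw [abs_mul, abs_of_nonneg (Int.fract_nonneg _)]
          refine (mul_le_of_le_one_left (abs_nonneg _) (Int.fract_lt_one _).le).trans ?_
          simp only [M, Matrix.of_apply, Int.cast_sum, Int.cast_mul]
          refine (Finset.abs_sum_le_sum_abs _ _).trans (Finset.sum_le_sum fun f _ => ?_)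
          rw [abs_mul, mul_comm]
          exact mul_le_mul_of_nonneg_left (hqB f) (abs_nonneg _)
      _ ≤ A * (B * N) := by
          simp only [← Finset.sum_mul]
          refine mul_le_mul_of_nonneg_right ?_ (mul_nonneg hB hN0)
          refine Finset.sum_le_sum fun g _ => ?_
          exact Finset.single_le_sum (f := fun h => ∑ f, |(k f g h : ℝ)|)
            (fun h _ => Finset.sum_nonneg fun f _ => abs_nonneg _) (Finset.mem_univ h)
      _ ≤ ((D + 1 : ℕ) : ℝ) * N := by
          rw [← mul_assoc]
          refine mul_le_mul_of_nonneg_right ?_ hN0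
          push_cast
          linarith
  · rw [hval]
    exact mul_nonneg hX.le hfr0
  · rw [hval, div_eq_mul_one_div, mul_comm]
    exact mul_le_mul hfr hXN.le hX.le (hfr0.trans hfr)

/-- The coefficient at `i₀`, where `θ i₀ = 1`, is absorbed by the fractional part. -/
theorem exists_sub_fract_linear_form_mem_Icc {ι : Type*} [Fintype ι] [DecidableEq ι] {θ : ι → ℝ}
    (hθ : ∀ i, 0 < θ i) (hlin : ∀ v : ι → ℤ, ∑ i, (v i : ℝ) * θ i = 0 → v = 0)
    {i₀ : ι} (h₀ : θ i₀ = 1) {m : ℕ} (hm : m ≠ 0) (hcard : Fintype.card ι = m + 1)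
    (hmul : ∀ i j, ∃ k : ι → ℤ, θ i * θ j = ∑ h, (k h : ℝ) * θ h) :
    ∃ C : ℝ, 0 < C ∧ ∀ α ∈ Set.Ico (0 : ℝ) 1, ∀ n : ℕ, 0 < n → ∃ c : ι → ℤ,
      (∀ i, i ≠ i₀ → (c i).natAbs ≤ n) ∧
      0 ≤ α - Int.fract (∑ i ∈ Finset.univ.erase i₀, (c i : ℝ) * θ i) ∧
      α - Int.fract (∑ i ∈ Finset.univ.erase i₀, (c i : ℝ) * θ i) ≤ C / (n : ℝ) ^ m := by
  obtain ⟨D, hD, H⟩ := exists_sub_linear_form_mem_Icc hθ hlin h₀ hm hcard hmul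
  have hS : 0 ≤ ∑ i, θ i := Finset.sum_nonneg fun i _ => (hθ i).le
  have hD1 : (1 : ℝ) ≤ D := by exact_mod_cast hD
  refine ⟨(1 + ∑ i, θ i) * (2 * D) ^ m, by positivity, fun α hα n hn => ?_⟩
  set C : ℝ := (1 + ∑ i, θ i) * (2 * D) ^ m with hC
  have hn0 : (0 : ℝ) < n := by exact_mod_cast hn
  by_cases hαC : α ≤ C / (n : ℝ) ^ m
  · exact ⟨0, by simp, by simpa using hα.1, by simpa using hαC⟩
  push Not at hαC
  have hDn : D ≤ n := by
    by_contra! hlt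
    have hnD : (n : ℝ) ≤ 2 * D := by
      have : (n : ℝ) < D := by exact_mod_cast hlt
      linarith
    have h1 : 1 ≤ C / (n : ℝ) ^ m := by
      rw [le_div_iff₀ (by positivity), one_mul]
      have := pow_le_pow_left₀ hn0.le hnD m
      have h2 : (0 : ℝ) ≤ (2 * D) ^ m := by positivity
      rw [hC]
      nlinarith
    linarith [hα.2]
  have hN : 0 < n / D := Nat.div_pos hDn hD
  have hDN : D * (n / D) ≤ n := Nat.mul_div_le n D
  have hnN : n ≤ 2 * D * (n / D) := by
    have h1 := Nat.lt_mul_div_succ n hD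
    nlinarith
  obtain ⟨w, hwb, hw0, hw1⟩ := H α (n / D) hN
  set N := n / D
  have hbound : (∑ i, θ i) / (N : ℝ) ^ m ≤ C / (n : ℝ) ^ m := by
    have hN0 : (0 : ℝ) < N := by exact_mod_cast hN
    have hnN' : (n : ℝ) ≤ 2 * D * N := by exact_mod_cast hnN
    rw [div_le_div_iff₀ (by positivity) (by positivity), hC, mul_assoc, ← mul_pow]
    have h2 : (n : ℝ) ^ m ≤ (2 * D * N) ^ m := pow_le_pow_left₀ hn0.le hnN' m
    exact mul_le_mul (by linarith) h2 (by positivity) (by positivity)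
  have hfr : Int.fract (∑ i ∈ Finset.univ.erase i₀, (w i : ℝ) * θ i) = ∑ i, (w i : ℝ) * θ i := by
    rw [Int.fract_eq_iff]
    refine ⟨by linarith, by linarith [hα.2], -w i₀, ?_⟩
    rw [← Finset.add_sum_erase Finset.univ (fun i => (w i : ℝ) * θ i) (Finset.mem_univ i₀), h₀]
    push_cast
    ring
  refine ⟨w, fun i hi => ?_, by rwa [hfr], by rw [hfr]; linarith⟩
  have h1 := hwb i hi
  have h2 : |w i| ≤ ((D * N : ℕ) : ℤ) := by
    rw [← Int.cast_abs] at h1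
    exact_mod_cast h1
  zify
  exact h2.trans (by exact_mod_cast hDN)

/-- The exponent of `p_i` in `∏ j, p_j ^ e j` is `e i`. -/
theorem padicValRat_prod_nth_prime_zpow {ξ : ℕ} (e : Fin ξ → ℤ) (i : Fin ξ) :
    padicValRat (Nat.nth Nat.Prime i) (∏ j : Fin ξ, (Nat.nth Nat.Prime j : ℚ) ^ e j) = e i := by
  have hp : ∀ j : ℕ, (Nat.nth Nat.Prime j).Prime := Nat.prime_nth_prime
  have := Fact.mk (hp i)
  have hgen : ∀ s : Finset (Fin ξ),
      padicValRat (Nat.nth Nat.Prime i) (∏ j ∈ s, (Nat.nth Nat.Prime j : ℚ) ^ e j) =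
        ∑ j ∈ s, if j = i then e j else 0 := by
    intro s
    induction s using Finset.induction_on with
    | empty => simp
    | insert j s hj ih =>
      have hne : ∀ j : Fin ξ, (Nat.nth Nat.Prime j : ℚ) ^ e j ≠ 0 := fun j =>
        zpow_ne_zero _ (by exact_mod_cast (hp j).ne_zero)
      rw [Finset.prod_insert hj, Finset.sum_insert hj, padicValRat.mul (hne j)
        (Finset.prod_ne_zero_iff.mpr fun j _ => hne j), ih, padicValRat.zpow, padicValRat.of_nat]
      congr 1
      by_cases hji : j = i
      · subst hji
        simp [padicValNat_self]
      · have : Nat.nth Nat.Prime i ≠ Nat.nth Nat.Prime j := fun h =>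
          hji (Fin.ext (Nat.nth_injective Nat.infinite_setOfPred_prime h).symm)
        have := Fact.mk (hp j)
        rw [if_neg hji, padicValNat_primes ‹_›]
        simp
  rw [hgen]
  simp

variable {d ξ : ℕ}

/-- The integer `∏ j, p_j ^ a j`, where `p_j` is the `j`-th prime. -/
noncomputable def primeMonomial (a : Fin ξ → Fin d) : ℕ :=
  ∏ j : Fin ξ, Nat.nth Nat.Prime j ^ (a j : ℕ)

theorem primeMonomial_pos (a : Fin ξ → Fin d) : 0 < primeMonomial a :=
  Finset.prod_pos fun j _ => pow_pos (Nat.prime_nth_prime j).pos _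

theorem eq_of_primeMonomial_div_eq_pow {a b : Fin ξ → Fin d} {r : ℚ}
    (h : (primeMonomial a : ℚ) / primeMonomial b = r ^ d) : a = b := by
  ext i
  have := Fact.mk (Nat.prime_nth_prime i)
  have hr : (primeMonomial a : ℚ) / primeMonomial b =
      ∏ j : Fin ξ, (Nat.nth Nat.Prime j : ℚ) ^ (((a j : ℕ) : ℤ) - ((b j : ℕ) : ℤ)) := by
    simp only [primeMonomial, Nat.cast_prod, Nat.cast_pow]
    rw [← Finset.prod_div_distrib]
    refine Finset.prod_congr rfl fun j _ => ?_
    rw [zpow_sub₀ (by exact_mod_cast (Nat.prime_nth_prime j).ne_zero), zpow_natCast, zpow_natCast]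
  have hv := padicValRat_prod_nth_prime_zpow (fun j => ((a j : ℕ) : ℤ) - ((b j : ℕ) : ℤ)) i
  rw [← hr, h, padicValRat.pow] at hv
  have hdvd : (d : ℤ) ∣ ((a i : ℕ) : ℤ) - ((b i : ℕ) : ℤ) := Dvd.intro _ hv
  have ha := (a i).isLt
  have hb := (b i).isLt
  have := Int.eq_zero_of_abs_lt_dvd hdvd (abs_lt.mpr ⟨by omega, by omega⟩)
  omega

theorem primeMonomial_injective :
    Function.Injective (primeMonomial : (Fin ξ → Fin d) → ℕ) := fun a b h =>
  eq_of_primeMonomial_div_eq_pow (r := 1) (by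
    rw [h, one_pow, div_self (by exact_mod_cast (primeMonomial_pos b).ne')])

theorem exists_primeMonomial_mul_eq (hd : 0 < d) (a b : Fin ξ → Fin d) :
    ∃ (t : ℕ) (c : Fin ξ → Fin d),
      primeMonomial a * primeMonomial b = t ^ d * primeMonomial c := by
  refine ⟨∏ j : Fin ξ, Nat.nth Nat.Prime j ^ (((a j : ℕ) + b j) / d),
    fun j => ⟨((a j : ℕ) + b j) % d, Nat.mod_lt _ hd⟩, ?_⟩
  simp only [primeMonomial]
  rw [← Finset.prod_pow, ← Finset.prod_mul_distrib, ← Finset.prod_mul_distrib]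
  refine Finset.prod_congr rfl fun j _ => ?_
  rw [← pow_add, ← pow_mul, ← pow_add, Nat.div_add_mod']

/-- The `d`-th roots of the `d`-th-power-free monomials in the first `ξ` primes are linearly
independent over `ℚ`. -/
theorem linearIndependent_primeMonomial_rpow_inv (hd : 0 < d) :
    LinearIndependent ℚ fun a : Fin ξ → Fin d => (primeMonomial a : ℝ) ^ ((d : ℝ)⁻¹) := by
  have hroot : ∀ a : Fin ξ → Fin d, ((primeMonomial a : ℝ) ^ ((d : ℝ)⁻¹)) ^ d = primeMonomial a :=
    fun a => Real.rpow_inv_natCast_pow (Nat.cast_nonneg _) hd.ne'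
  refine linearIndependent_of_pow_eq_of_irrational_div
    (fun a => Real.rpow_pos_of_pos (by exact_mod_cast primeMonomial_pos a) _) hd
    (fun a => ⟨primeMonomial a, by rw [hroot]; push_cast; rfl⟩) ?_
  rintro a b hab ⟨r, hr⟩
  refine hab (eq_of_primeMonomial_div_eq_pow (r := r) ?_)
  have h := congrArg (· ^ d) hr
  simp only [div_pow, hroot] at h
  have h' : (((primeMonomial a : ℚ) / primeMonomial b : ℚ) : ℝ) = ((r ^ d : ℚ) : ℝ) := by
    push_cast
    exact h.symm
  exact_mod_cast h'

theorem stmt_13 (d ξ : ℕ) (hd : 2 ≤ d) (hξ : 1 ≤ ξ) :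
    ∃ C : ℝ, 0 < C ∧ ∀ α : ℝ, α ∈ Set.Ico (0 : ℝ) 1 → ∀ n : ℕ, 1 ≤ n →
      ∃ c : ℕ → ℤ, (∀ f ∈ PstarSet d ξ, (c f).natAbs ≤ n) ∧
        0 ≤ α - Int.fract (∑ f ∈ PstarSet d ξ, (c f : ℝ) * (f : ℝ) ^ ((d : ℝ)⁻¹)) ∧
        α - Int.fract (∑ f ∈ PstarSet d ξ, (c f : ℝ) * (f : ℝ) ^ ((d : ℝ)⁻¹)) ≤
          C * (n : ℝ) ^ (-(d : ℝ) ^ ξ + 1) := by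
  have hd0 : 0 < d := by omega
  have hinj : Function.Injective (primeMonomial : (Fin ξ → Fin d) → ℕ) :=
    primeMonomial_injective
  let i₀ : Fin ξ → Fin d := fun _ => ⟨0, hd0⟩
  have hi₀ : primeMonomial i₀ = 1 := by simp [primeMonomial, i₀]
  have hP : PstarSet d ξ = (Finset.univ.erase i₀).image primeMonomial := by
    rw [Finset.image_erase hinj, hi₀]
    rfl
  let θ : (Fin ξ → Fin d) → ℝ := fun a => (primeMonomial a : ℝ) ^ ((d : ℝ)⁻¹)
  have hlin : ∀ v : (Fin ξ → Fin d) → ℤ, ∑ a, (v a : ℝ) * θ a = 0 → v = 0 := by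
    intro v hv
    have h := Fintype.linearIndependent_iff.mp
      (linearIndependent_primeMonomial_rpow_inv (ξ := ξ) hd0)
      (fun a => (v a : ℚ)) (by simpa [Rat.smul_def] using hv)
    ext a
    exact_mod_cast h a
  have hmul : ∀ a b, ∃ k : (Fin ξ → Fin d) → ℤ, θ a * θ b = ∑ h, (k h : ℝ) * θ h := by
    intro a b
    obtain ⟨t, c, h⟩ := exists_primeMonomial_mul_eq hd0 a b
    refine ⟨Pi.single c (t : ℤ), ?_⟩
    rw [Finset.sum_eq_single c (fun i _ hi => by simp [hi]) (by simp), Pi.single_eq_same]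
    simp only [θ]
    rw [← Real.mul_rpow (by positivity) (by positivity), ← Nat.cast_mul, h]
    push_cast
    rw [Real.mul_rpow (by positivity) (by positivity),
      Real.pow_rpow_inv_natCast (by positivity) hd0.ne']
  have hpow : 1 < d ^ ξ := Nat.one_lt_pow (by omega) (by omega)
  obtain ⟨C, hC, H⟩ := exists_sub_fract_linear_form_mem_Icc (θ := θ) (i₀ := i₀) (m := d ^ ξ - 1)
    (fun a => Real.rpow_pos_of_pos (by exact_mod_cast primeMonomial_pos a) _) hlin
    (by simp [θ, hi₀]) (by omega)
    (by rw [Fintype.card_fun, Fintype.card_fin, Fintype.card_fin]; omega) hmul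
  refine ⟨C, hC, fun α hα n hn => ?_⟩
  obtain ⟨c, hcn, h0, h1⟩ := H α hα n hn
  have hsum : ∑ f ∈ PstarSet d ξ,
      ((Function.extend primeMonomial c 0 f : ℤ) : ℝ) * (f : ℝ) ^ ((d : ℝ)⁻¹) =
        ∑ a ∈ Finset.univ.erase i₀, (c a : ℝ) * θ a := by
    rw [hP, Finset.sum_image hinj.injOn]
    exact Finset.sum_congr rfl fun a _ => by rw [hinj.extend_apply]
  refine ⟨Function.extend primeMonomial c 0, ?_, by rwa [hsum], ?_⟩
  · rw [hP]
    intro f hf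
    obtain ⟨a, ha, rfl⟩ := Finset.mem_image.mp hf
    rw [hinj.extend_apply]
    exact hcn a (Finset.ne_of_mem_erase ha)
  · rw [hsum]
    refine h1.trans_eq ?_
    rw [show -(d : ℝ) ^ ξ + 1 = -((d ^ ξ - 1 : ℕ) : ℝ) by
      rw [Nat.cast_sub hpow.le]; push_cast; ring, Real.rpow_neg (by positivity), Real.rpow_natCast,
      div_eq_mul_inv]
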